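/- arXiv:1805.05529 — 2 statements merged into one kernel-verified Lean document; each statement's English description precedes it below -/
import Mathlib

section
/- Let N be a positive integer and let σ_1, …, σ_N > 0. Let X be a random N×N real matrix whose rows are independent, with row l distributed according to the Gaussian density (2πσ_l²)^{-N/2} exp(−|x|²/(2σ_l²)) with respect to Lebesgue measure on ℝ^N. Then for every real α > −1/2 the expectation E[|det X|^{2α}] is finite and equals ∏_{l=1}^N (2σ_l²)^α Γ((N−l+1)/2 + α) / Γ((N−l+1)/2). -/
open MeasureTheory Real

/-- The distribution on `ℝ^N` of a row with isotropic Gaussian density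
`(2πσ²)^{-N/2} exp(-|x|²/(2σ²))` with respect to Lebesgue measure. -/
noncomputable def gaussianRowMeasure (N : ℕ) (σ : ℝ) : Measure (Fin N → ℝ) :=
  volume.withDensity fun x =>
    ENNReal.ofReal ((2 * π * σ ^ 2) ^ (-(N : ℝ) / 2) *
      Real.exp (-(∑ j, x j ^ 2) / (2 * σ ^ 2)))

theorem MeasureTheory.MeasurePreserving.withDensity_comp {α β : Type*} [MeasurableSpace α]
    [MeasurableSpace β] {μ : Measure α} {ν : Measure β} {e : α → β} (he : MeasurePreserving e μ ν)
    {f : β → ENNReal} (hf : Measurable f) :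
    MeasurePreserving e (μ.withDensity (f ∘ e)) (ν.withDensity f) := by
  refine ⟨he.measurable, Measure.ext fun s hs => ?_⟩
  rw [Measure.map_apply he.measurable hs, withDensity_apply _ (he.measurable hs),
    withDensity_apply _ hs]
  exact he.setLIntegral_comp_preimage hs hf

theorem measurable_gaussianRowMeasure_density (N : ℕ) (σ : ℝ) :
    Measurable fun x : Fin N → ℝ => ENNReal.ofReal ((2 * π * σ ^ 2) ^ (-(N : ℝ) / 2) *
      Real.exp (-(∑ j, x j ^ 2) / (2 * σ ^ 2))) := by
  fun_prop

instance (N : ℕ) (σ : ℝ) : SigmaFinite (gaussianRowMeasure N σ) := by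
  unfold gaussianRowMeasure
  infer_instance

theorem measurePreserving_piFinSuccAbove_gaussianRowMeasure (N : ℕ) {σ : ℝ} (hσ : 0 < σ) :
    MeasurePreserving (MeasurableEquiv.piFinSuccAbove (fun _ : Fin (N + 1) => ℝ) 0)
      (gaussianRowMeasure (N + 1) σ)
      ((ProbabilityTheory.gaussianReal 0 (σ ^ 2).toNNReal).prod (gaussianRowMeasure N σ)) := by
  have hv : (σ ^ 2).toNNReal ≠ 0 := by simpa using hσ.ne'
  rw [ProbabilityTheory.gaussianReal_of_var_ne_zero 0 hv, gaussianRowMeasure.eq_1 N,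
    prod_withDensity (ProbabilityTheory.measurable_gaussianPDF _ _)
      (measurable_gaussianRowMeasure_density N σ)]
  convert (volume_preserving_piFinSuccAbove (fun _ : Fin (N + 1) => ℝ) 0).withDensity_comp
    (f := fun z => ProbabilityTheory.gaussianPDF 0 (σ ^ 2).toNNReal z.1 *
      ENNReal.ofReal ((2 * π * σ ^ 2) ^ (-(N : ℝ) / 2) *
        Real.exp (-(∑ j, z.2 j ^ 2) / (2 * σ ^ 2)))) (by fun_prop) using 1
  swap
  · rfl
  rw [gaussianRowMeasure]
  congr 1
  ext x
  have hs : (0 : ℝ) < 2 * π * σ ^ 2 := by positivity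
  simp only [Function.comp_apply, ProbabilityTheory.gaussianPDF,
    ProbabilityTheory.gaussianPDFReal]
  rw [← ENNReal.ofReal_mul (by positivity)]
  congr 1
  rw [Fin.sum_univ_succ, neg_add, add_div, Real.exp_add, Real.coe_toNNReal _ (by positivity),
    Real.sqrt_eq_rpow, ← Real.rpow_neg hs.le,
    show (-((N + 1 : ℕ) : ℝ) / 2) = -(1 / 2) + -(N : ℝ) / 2 by push_cast; ring,
    Real.rpow_add hs]
  simp [MeasurableEquiv.piFinSuccAbove, Fin.insertNthEquiv, Fin.tail]
  ring

theorem measurePreserving_tail_gaussianRowMeasure (N : ℕ) {σ : ℝ} (hσ : 0 < σ) :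
    MeasurePreserving (fun (x : Fin (N + 1) → ℝ) (j : Fin N) => x j.succ)
      (gaussianRowMeasure (N + 1) σ) (gaussianRowMeasure N σ) :=
  measurePreserving_snd.comp (measurePreserving_piFinSuccAbove_gaussianRowMeasure N hσ)

/-- A linear isometry of Euclidean space, acting on plain coordinate vectors. -/
noncomputable def coordIsometry {N : ℕ}
    (T : EuclideanSpace ℝ (Fin N) ≃ₗᵢ[ℝ] EuclideanSpace ℝ (Fin N)) :
    (Fin N → ℝ) →ₗ[ℝ] (Fin N → ℝ) :=
  (WithLp.linearEquiv 2 ℝ (Fin N → ℝ)).conj T.toLinearEquiv.toLinearMap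

section

variable {N : ℕ} (T : EuclideanSpace ℝ (Fin N) ≃ₗᵢ[ℝ] EuclideanSpace ℝ (Fin N))

theorem coordIsometry_apply (x : Fin N → ℝ) :
    coordIsometry T x = WithLp.ofLp (T (WithLp.toLp 2 x)) := rfl

theorem sum_sq_coordIsometry (x : Fin N → ℝ) :
    ∑ j, coordIsometry T x j ^ 2 = ∑ j, x j ^ 2 := by
  rw [coordIsometry_apply, ← EuclideanSpace.real_norm_sq_eq, T.norm_map,
    EuclideanSpace.real_norm_sq_eq]

theorem abs_det_coordIsometry : |LinearMap.det (coordIsometry T)| = 1 := by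
  have h := T.toLinearIsometry.normDet_eq_one
  rw [LinearMap.normDet_eq_abs_det] at h
  rw [← h]
  exact congrArg abs (LinearMap.det_conj _ (WithLp.linearEquiv 2 ℝ (Fin N → ℝ)))

theorem measurePreserving_coordIsometry (σ : ℝ) :
    MeasurePreserving (coordIsometry T) (gaussianRowMeasure N σ) (gaussianRowMeasure N σ) := by
  have hT : MeasurePreserving (coordIsometry T) :=
    (PiLp.volume_preserving_ofLp (Fin N)).comp
      (T.measurePreserving.comp (PiLp.volume_preserving_toLp (Fin N)))
  have h := hT.withDensity_comp (measurable_gaussianRowMeasure_density N σ)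
  simp only [Function.comp_def, sum_sq_coordIsometry] at h
  exact h

theorem abs_det_of_coordIsometry (M : Fin N → Fin N → ℝ) :
    |Matrix.det (Matrix.of fun i => coordIsometry T (M i))| = |Matrix.det (Matrix.of M)| := by
  have h : (Matrix.of fun i => coordIsometry T (M i)) =
      Matrix.of M * (LinearMap.toMatrix' (coordIsometry T)).transpose := by
    ext i j
    conv_lhs => rw [Matrix.of_apply, ← LinearMap.toMatrix'_mulVec]
    simp [Matrix.mulVec, dotProduct, Matrix.mul_apply, mul_comm]
  rw [h, Matrix.det_mul, Matrix.det_transpose, LinearMap.det_toMatrix', abs_mul,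
    abs_det_coordIsometry, mul_one]

end

theorem exists_coordIsometry_eq (N : ℕ) (x : Fin (N + 1) → ℝ) :
    ∃ T : EuclideanSpace ℝ (Fin (N + 1)) ≃ₗᵢ[ℝ] EuclideanSpace ℝ (Fin (N + 1)),
      coordIsometry T x = Pi.single 0 √(∑ j, x j ^ 2) := by
  have h : ‖WithLp.toLp 2 x‖ = ‖(EuclideanSpace.single 0 √(∑ j, x j ^ 2) :
      EuclideanSpace ℝ (Fin (N + 1)))‖ := by
    rw [PiLp.norm_single, EuclideanSpace.norm_eq, Real.norm_of_nonneg (Real.sqrt_nonneg _)]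
    simp
  refine ⟨Submodule.reflection (ℝ ∙ (WithLp.toLp 2 x -
    (EuclideanSpace.single 0 √(∑ j, x j ^ 2) : EuclideanSpace ℝ (Fin (N + 1)))))ᗮ, ?_⟩
  rw [coordIsometry_apply, Submodule.reflection_sub h]
  rfl

theorem det_of_cons_single (N : ℕ) (r : ℝ) (M : Fin N → Fin (N + 1) → ℝ) :
    Matrix.det (Matrix.of (Fin.cons (Pi.single 0 r) M : Fin (N + 1) → Fin (N + 1) → ℝ)) =
      r * Matrix.det (Matrix.of fun i j => M i (Fin.succ j)) := by
  rw [Matrix.det_succ_row_zero, Finset.sum_eq_single 0]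
  · simp only [Fin.val_zero, pow_zero, one_mul, Matrix.of_apply, Fin.cons_zero, Pi.single_eq_same]
    rfl
  · intro j _ hj
    simp [hj]
  · simp

theorem lintegral_sum_sq_rpow_gaussianRowMeasure (N : ℕ) {σ α : ℝ} (hσ : 0 < σ)
    (hα : -(1 / 2 : ℝ) < α) :
    ∫⁻ x, ENNReal.ofReal (√(∑ j, x j ^ 2) ^ (2 * α)) ∂gaussianRowMeasure (N + 1) σ =
      ENNReal.ofReal ((2 * σ ^ 2) ^ α *
        (Real.Gamma (((N + 1 : ℕ) : ℝ) / 2 + α) / Real.Gamma (((N + 1 : ℕ) : ℝ) / 2))) := by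
  set c : ℝ := (2 * π * σ ^ 2) ^ (-((N + 1 : ℕ) : ℝ) / 2) with hc
  have hs : (0 : ℝ) < 2 * σ ^ 2 := by positivity
  have hq : -1 < (N : ℝ) + 2 * α := by have : (0 : ℝ) ≤ N := N.cast_nonneg; linarith
  let f : ℝ → ℝ := fun r => c * (Real.exp (-(2 * σ ^ 2)⁻¹ * r ^ (2 : ℝ)) * r ^ (2 * α))
  have hpow : Set.EqOn (fun y : ℝ => y ^ N • f y)
      (fun y => c * (y ^ ((N : ℝ) + 2 * α) * Real.exp (-(2 * σ ^ 2)⁻¹ * y ^ (2 : ℝ))))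
      (Set.Ioi 0) := by
    intro y hy
    simp only [f, smul_eq_mul]
    rw [Real.rpow_add hy, Real.rpow_natCast]
    ring
  have hint : Integrable (fun x : EuclideanSpace ℝ (Fin (N + 1)) => f ‖x‖) := by
    rw [integrable_fun_norm_addHaar]
    simp only [finrank_euclideanSpace, Fintype.card_fin, Nat.add_sub_cancel]
    rw [integrableOn_congr_fun hpow measurableSet_Ioi]
    exact (integrableOn_rpow_mul_exp_neg_mul_rpow hq two_pos (inv_pos.2 hs)).const_mul c
  calc
    _ = ∫⁻ x : Fin (N + 1) → ℝ, ENNReal.ofReal (f ‖WithLp.toLp 2 x‖) := by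
      rw [gaussianRowMeasure, lintegral_withDensity_eq_lintegral_mul _
        (measurable_gaussianRowMeasure_density _ σ) (by fun_prop)]
      refine lintegral_congr fun x => ?_
      rw [Pi.mul_apply, ← ENNReal.ofReal_mul (by positivity)]
      congr 1
      simp only [f, Real.rpow_two, EuclideanSpace.real_norm_sq_eq]
      rw [EuclideanSpace.norm_eq]
      simp only [Real.norm_eq_abs, sq_abs]
      rw [mul_assoc]
      congr 4
      field_simp
    _ = ∫⁻ x : EuclideanSpace ℝ (Fin (N + 1)), ENNReal.ofReal (f ‖x‖) :=
      (PiLp.volume_preserving_toLp (Fin (N + 1))).lintegral_comp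
        (f := fun x => ENNReal.ofReal (f ‖x‖)) (by fun_prop)
    _ = ENNReal.ofReal (∫ x : EuclideanSpace ℝ (Fin (N + 1)), f ‖x‖) := by
      rw [ofReal_integral_eq_lintegral_ofReal hint]
      exact Filter.Eventually.of_forall fun x => by positivity
    _ = _ := by
      congr 1
      rw [integral_fun_norm_addHaar]
      simp only [finrank_euclideanSpace, Fintype.card_fin, Nat.add_sub_cancel]
      rw [setIntegral_congr_fun measurableSet_Ioi hpow, integral_const_mul,
        integral_rpow_mul_exp_neg_mul_rpow two_pos hq (inv_pos.2 hs), Measure.real,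
        EuclideanSpace.volume_ball]
      have hn : (0 : ℝ) < ((N + 1 : ℕ) : ℝ) / 2 := by positivity
      have hG := Real.Gamma_pos_of_pos hn
      simp only [Fintype.card_fin, ENNReal.ofReal_one, one_pow, one_mul, smul_eq_mul,
        nsmul_eq_mul]
      rw [ENNReal.toReal_ofReal (by positivity), Real.Gamma_add_one hn.ne',
        show ((N : ℝ) + 2 * α + 1) / 2 = ((N + 1 : ℕ) : ℝ) / 2 + α by push_cast; ring,
        show -((N : ℝ) + 2 * α + 1) / 2 = -(((N + 1 : ℕ) : ℝ) / 2 + α) by push_cast; ring,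
        Real.inv_rpow hs.le, Real.rpow_neg hs.le, inv_inv, Real.rpow_add hs, hc,
        show 2 * π * σ ^ 2 = π * (2 * σ ^ 2) by ring, neg_div, Real.rpow_neg (by positivity),
        Real.mul_rpow pi_pos.le hs.le, Real.sqrt_eq_rpow, ← Real.rpow_natCast,
        ← Real.rpow_mul pi_pos.le, one_div_mul_eq_div]
      have h1 : (0 : ℝ) < π ^ (((N + 1 : ℕ) : ℝ) / 2) := by positivity
      have h2 : (0 : ℝ) < (2 * σ ^ 2) ^ (((N + 1 : ℕ) : ℝ) / 2) := by positivity
      have h3 : ((N + 1 : ℕ) : ℝ) ≠ 0 := by positivity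
      generalize π ^ (((N + 1 : ℕ) : ℝ) / 2) = A at *
      generalize (2 * σ ^ 2) ^ (((N + 1 : ℕ) : ℝ) / 2) = B at *
      generalize (2 * σ ^ 2) ^ α = C at *
      field_simp

theorem measurable_ofReal_abs_det_rpow (N : ℕ) (α : ℝ) :
    Measurable fun M : Fin N → Fin N → ℝ =>
      ENNReal.ofReal (|Matrix.det (Matrix.of M)| ^ (2 * α)) := by
  have : Measurable fun M : Fin N → Fin N → ℝ => Matrix.det (Matrix.of M) :=
    (Continuous.matrix_det (by fun_prop)).measurable
  fun_prop

theorem lintegral_abs_det_cons (N : ℕ) (σ : Fin N → ℝ) (hσ : ∀ l, 0 < σ l) (α : ℝ)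
    (x : Fin (N + 1) → ℝ) :
    ∫⁻ M : Fin N → Fin (N + 1) → ℝ, ENNReal.ofReal
        (|Matrix.det (Matrix.of (Fin.cons x M : Fin (N + 1) → Fin (N + 1) → ℝ))| ^ (2 * α))
        ∂(Measure.pi fun l => gaussianRowMeasure (N + 1) (σ l)) =
      ENNReal.ofReal (√(∑ j, x j ^ 2) ^ (2 * α)) *
        ∫⁻ M : Fin N → Fin N → ℝ, ENNReal.ofReal (|Matrix.det (Matrix.of M)| ^ (2 * α))
          ∂(Measure.pi fun l => gaussianRowMeasure N (σ l)) := by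
  obtain ⟨T, hT⟩ := exists_coordIsometry_eq N x
  have hrot := measurePreserving_pi (fun l => gaussianRowMeasure (N + 1) (σ l))
    (fun l => gaussianRowMeasure (N + 1) (σ l)) fun l => measurePreserving_coordIsometry T (σ l)
  have htail := measurePreserving_pi (fun l => gaussianRowMeasure (N + 1) (σ l))
    (fun l => gaussianRowMeasure N (σ l))
    fun l => measurePreserving_tail_gaussianRowMeasure N (hσ l)
  have hminor : Measurable fun M : Fin N → Fin (N + 1) → ℝ =>
      ENNReal.ofReal (|Matrix.det (Matrix.of fun i j => M i (Fin.succ j))| ^ (2 * α)) :=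
    (measurable_ofReal_abs_det_rpow N α).comp htail.measurable
  rw [← htail.lintegral_comp (measurable_ofReal_abs_det_rpow N α),
    ← lintegral_const_mul _ hminor, ← hrot.lintegral_comp (hminor.const_mul _)]
  refine lintegral_congr fun M => ?_
  rw [← ENNReal.ofReal_mul (by positivity), ← abs_det_of_coordIsometry T]
  have h : (fun i => coordIsometry T ((Fin.cons x M : Fin (N + 1) → Fin (N + 1) → ℝ) i)) =
      Fin.cons (Pi.single 0 √(∑ j, x j ^ 2)) fun i => coordIsometry T (M i) := by
    ext i : 1
    refine Fin.cases ?_ (fun i => ?_) i <;> simp [hT]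
  rw [h, det_of_cons_single, abs_mul, abs_of_nonneg (Real.sqrt_nonneg _),
    Real.mul_rpow (Real.sqrt_nonneg _) (abs_nonneg _)]

theorem prod_gamma_ratio_nonneg (N : ℕ) (σ : Fin N → ℝ) {α : ℝ} (hα : -(1 / 2 : ℝ) < α) :
    0 ≤ ∏ l : Fin N, (2 * σ l ^ 2) ^ α *
        (Real.Gamma (((N : ℝ) - (l : ℕ)) / 2 + α) /
          Real.Gamma (((N : ℝ) - (l : ℕ)) / 2)) := by
  refine Finset.prod_nonneg fun l _ => ?_
  have h : ((l : ℕ) : ℝ) + 1 ≤ N := by exact_mod_cast l.2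
  have h1 := Real.Gamma_pos_of_pos (show 0 < ((N : ℝ) - (l : ℕ)) / 2 + α by linarith)
  have h2 := Real.Gamma_pos_of_pos (show 0 < ((N : ℝ) - (l : ℕ)) / 2 by linarith)
  positivity

theorem lintegral_abs_det_rpow (N : ℕ) (σ : Fin N → ℝ) (hσ : ∀ l, 0 < σ l)
    (α : ℝ) (hα : -(1 / 2 : ℝ) < α) :
    ∫⁻ M : Fin N → Fin N → ℝ, ENNReal.ofReal (|Matrix.det (Matrix.of M)| ^ (2 * α))
        ∂(Measure.pi fun l => gaussianRowMeasure N (σ l)) =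
      ENNReal.ofReal (∏ l : Fin N, (2 * σ l ^ 2) ^ α *
        (Real.Gamma (((N : ℝ) - (l : ℕ)) / 2 + α) /
          Real.Gamma (((N : ℝ) - (l : ℕ)) / 2))) := by
  induction N with
  | zero => simp
  | succ N ih =>
    rw [← (measurePreserving_piFinSuccAbove (fun l => gaussianRowMeasure (N + 1) (σ l))
        0).symm.lintegral_comp (measurable_ofReal_abs_det_rpow _ α),
      lintegral_prod]
    swap
    · exact ((measurable_ofReal_abs_det_rpow _ α).comp
        (MeasurableEquiv.measurable _)).aemeasurable
    simp only [MeasurableEquiv.piFinSuccAbove_symm_apply, Fin.insertNthEquiv_zero,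
      Fin.zero_succAbove]
    have h := lintegral_abs_det_cons N (fun l => σ l.succ) (fun l => hσ _) α
    refine (lintegral_congr h).trans ?_
    rw [lintegral_mul_const _ (by fun_prop), ih _ fun l => hσ _,
      lintegral_sum_sq_rpow_gaussianRowMeasure N (hσ 0) hα,
      ← ENNReal.ofReal_mul' (prod_gamma_ratio_nonneg N _ hα), Fin.prod_univ_succ]
    simp

theorem statement0 (N : ℕ) (hN : 0 < N) (σ : Fin N → ℝ) (hσ : ∀ l, 0 < σ l)
    (α : ℝ) (hα : -(1 / 2 : ℝ) < α) :
    Integrable (fun M : Fin N → Fin N → ℝ => |Matrix.det (Matrix.of M)| ^ (2 * α))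
      (Measure.pi fun l => gaussianRowMeasure N (σ l)) ∧
    ∫ M : Fin N → Fin N → ℝ, |Matrix.det (Matrix.of M)| ^ (2 * α)
        ∂(Measure.pi fun l => gaussianRowMeasure N (σ l)) =
      ∏ l : Fin N, (2 * σ l ^ 2) ^ α *
        (Real.Gamma (((N : ℝ) - (l : ℕ)) / 2 + α) /
          Real.Gamma (((N : ℝ) - (l : ℕ)) / 2)) := by
  have hmeas : Measurable fun M : Fin N → Fin N → ℝ => |Matrix.det (Matrix.of M)| ^ (2 * α) := by
    simpa [ENNReal.toReal_ofReal, Real.rpow_nonneg] using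
      (measurable_ofReal_abs_det_rpow N α).ennreal_toReal
  have hnn : ∀ M : Fin N → Fin N → ℝ, 0 ≤ |Matrix.det (Matrix.of M)| ^ (2 * α) :=
    fun M => by positivity
  have h := lintegral_abs_det_rpow N σ hσ α hα
  refine ⟨(lintegral_ofReal_ne_top_iff_integrable hmeas.aestronglyMeasurable
    (Filter.Eventually.of_forall hnn)).1 (h ▸ ENNReal.ofReal_ne_top), ?_⟩
  rw [integral_eq_lintegral_of_nonneg_ae (Filter.Eventually.of_forall hnn)
    hmeas.aestronglyMeasurable, h, ENNReal.toReal_ofReal (prod_gamma_ratio_nonneg N σ hα)]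
end

section
/- Let N be a positive integer and let σ_1, …, σ_N > 0. Let X be a random N×N real matrix whose rows are independent, with row l distributed according to the Gaussian density (2πσ_l²)^{-N/2} exp(−|x|²/(2σ_l²)) on ℝ^N. Then the law of |det X|², i.e. the pushforward of the distribution of X under X ↦ (det X)², equals the law of ∏_{l=1}^N σ_l² Z_l, where Z_1, …, Z_N are independent and Z_l has the chi-squared distribution with l degrees of freedom. -/
open MeasureTheory Real

/-- The chi-squared distribution with `k` degrees of freedom: the measure on `(0,∞)`
with density `x^{k/2-1} e^{-x/2} / (2^{k/2} Γ(k/2))` with respect to Lebesgue measure. -/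
noncomputable def chiSquaredMeasure (k : ℕ) : Measure ℝ :=
  volume.withDensity fun x =>
    ENNReal.ofReal (if 0 < x then
      x ^ ((k : ℝ) / 2 - 1) * Real.exp (-x / 2) /
        ((2 : ℝ) ^ ((k : ℝ) / 2) * Real.Gamma ((k : ℝ) / 2))
    else 0)

open ProbabilityTheory
open scoped NNReal ENNReal

/-- The Tonelli theorem for a product of functions of one coordinate each. -/
theorem lintegral_pi_prod_eq_prod {n : ℕ} (μ : Fin n → Measure ℝ) [∀ i, SigmaFinite (μ i)]
    {f : Fin n → ℝ → ℝ≥0∞} (hf : ∀ i, Measurable (f i)) :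
    ∫⁻ x, ∏ i, f i (x i) ∂Measure.pi μ = ∏ i, ∫⁻ t, f i t ∂μ i := by
  induction n with
  | zero => simp
  | succ n ih =>
    have e := (measurePreserving_piFinSuccAbove μ 0).symm
    rw [← e.lintegral_comp (by fun_prop)]
    simp only [MeasurableEquiv.piFinSuccAbove_symm_apply, Fin.prod_univ_succ, Fin.insertNthEquiv,
      Equiv.coe_fn_mk, Fin.insertNth_zero, Fin.cons_zero, Fin.cons_succ, Fin.zero_succAbove,
      cast_eq]
    rw [lintegral_prod_mul (g := fun x : Fin n → ℝ => ∏ i, f i.succ (x i)) (hf 0).aemeasurable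
      (Finset.measurable_prod _ fun i _ => (hf i.succ).comp (measurable_pi_apply i)).aemeasurable,
      ih _ (fun i => hf i.succ)]

/-- An isotropic Gaussian vector has independent Gaussian coordinates. -/
theorem gaussianRowMeasure_eq_pi (n : ℕ) {σ : ℝ} (hσ : 0 < σ) :
    gaussianRowMeasure n σ =
      Measure.pi fun _ : Fin n => gaussianReal 0 (NNReal.mk (σ ^ 2) (sq_nonneg σ)) := by
  have hv : NNReal.mk (σ ^ 2) (sq_nonneg σ) ≠ 0 := by
    intro h
    have := congrArg NNReal.toReal h
    simp [hσ.ne'] at this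
  refine (Measure.pi_eq fun s hs => ?_).symm
  simp_rw [gaussianReal_apply 0 hv]
  rw [gaussianRowMeasure, withDensity_apply _ (MeasurableSet.univ_pi hs), volume_pi,
    Measure.restrict_pi_pi, ← lintegral_pi_prod_eq_prod _ fun _ => measurable_gaussianPDF _ _]
  refine lintegral_congr fun x => ?_
  simp only [gaussianPDF]
  rw [← ENNReal.ofReal_prod_of_nonneg fun _ _ => gaussianPDFReal_nonneg _ _ _]
  congr 1
  simp only [gaussianPDFReal, Finset.prod_mul_distrib, Finset.prod_const, Finset.card_univ,
    Fintype.card_fin, ← Real.exp_sum, NNReal.coe_mk, sub_zero]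
  congr 1
  · rw [Real.sqrt_eq_rpow, ← Real.rpow_neg (by positivity),
      ← Real.rpow_mul_natCast (by positivity)]
    congr 1
    ring
  · rw [← Finset.sum_div, Finset.sum_neg_distrib]

theorem gaussianRowMeasure_one_eq_pi (n : ℕ) :
    gaussianRowMeasure n 1 = Measure.pi fun _ : Fin n => gaussianReal 0 1 := by
  rw [gaussianRowMeasure_eq_pi n one_pos]
  congr! 3
  simp

/-- An isotropic Gaussian vector is a rescaled standard Gaussian vector. -/
theorem gaussianRowMeasure_eq_map (n : ℕ) {σ : ℝ} (hσ : 0 < σ) :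
    gaussianRowMeasure n σ =
      (Measure.pi fun _ : Fin n => gaussianReal 0 1).map fun x i => σ * x i := by
  rw [gaussianRowMeasure_eq_pi n hσ, Measure.pi_map_pi (f := fun _ : Fin n => (σ * ·))
    (by fun_prop)]
  simp_rw [gaussianReal_map_const_mul]
  simp

/-- Integration of a radial function in polar coordinates. -/
theorem lintegral_fun_norm_addHaar {E : Type*} [NormedAddCommGroup E] [NormedSpace ℝ E]
    [FiniteDimensional ℝ E] [Nontrivial E] [MeasurableSpace E] [BorelSpace E] (μ : Measure E)
    [μ.IsAddHaarMeasure] {f : ℝ → ℝ≥0∞} (hf : Measurable f) :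
    ∫⁻ x, f ‖x‖ ∂μ = Module.finrank ℝ E * μ (Metric.ball 0 1) *
      ∫⁻ r in Set.Ioi (0 : ℝ), ENNReal.ofReal (r ^ (Module.finrank ℝ E - 1)) * f r :=
  calc
    ∫⁻ x, f ‖x‖ ∂μ = ∫⁻ x : ({(0)}ᶜ : Set E), f ‖x.1‖ ∂(μ.comap (↑)) := by
      rw [lintegral_subtype_comap (measurableSet_singleton _).compl fun x ↦ f ‖x‖,
        restrict_compl_singleton]
    _ = ∫⁻ x, f x.2 ∂μ.toSphere.prod (.volumeIoiPow (Module.finrank ℝ E - 1)) := by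
      simpa using μ.measurePreserving_homeomorphUnitSphereProd.lintegral_comp
        (f := f ∘ Subtype.val ∘ Prod.snd) (by fun_prop)
    _ = _ := by
      rw [lintegral_prod _ (by fun_prop)]
      simp only [lintegral_const]
      rw [Measure.toSphere_apply_univ, mul_comm, Measure.volumeIoiPow,
        lintegral_withDensity_eq_lintegral_mul _ (by fun_prop) (by fun_prop)]
      congr 1
      exact lintegral_subtype_comap measurableSet_Ioi
        fun r : ℝ => ENNReal.ofReal (r ^ (Module.finrank ℝ E - 1)) * f r

/-- The squared Euclidean norm of a standard Gaussian vector has the chi-squared distribution. -/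
theorem map_sum_sq_pi_gaussianReal (n : ℕ) :
    (Measure.pi fun _ : Fin (n + 1) => gaussianReal 0 1).map (fun x => ∑ i, x i ^ 2) =
      chiSquaredMeasure (n + 1) := by
  set c : ℝ := (2 * π) ^ (-((n + 1 : ℕ) : ℝ) / 2) with hc
  set d : ℝ := (2 : ℝ) ^ (((n + 1 : ℕ) : ℝ) / 2) * Real.Gamma (((n + 1 : ℕ) : ℝ) / 2) with hd
  have hd0 : 0 < d := mul_pos (by positivity) (Real.Gamma_pos_of_pos (by positivity))
  have hconst : ((n + 1 : ℕ) : ℝ) *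
      (√π ^ (n + 1) / Real.Gamma (((n + 1 : ℕ) : ℝ) / 2 + 1)) * c = 2 / d := by
    have hG : 0 < Real.Gamma (((n + 1 : ℕ) : ℝ) / 2) := Real.Gamma_pos_of_pos (by positivity)
    have hN : (0 : ℝ) < ((n + 1 : ℕ) : ℝ) := by positivity
    rw [Real.Gamma_add_one (by positivity), hc, hd, neg_div, Real.rpow_neg (by positivity),
      Real.mul_rpow (by positivity) (by positivity), Real.sqrt_eq_rpow,
      ← Real.rpow_mul_natCast (by positivity), one_div_mul_eq_div]
    field_simp
  ext s hs
  let F : ℝ → ℝ≥0∞ := fun r =>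
    s.indicator 1 (r ^ 2) * ENNReal.ofReal (c * Real.exp (-r ^ 2 / 2))
  have hind : Measurable (s.indicator (1 : ℝ → ℝ≥0∞)) := measurable_one.indicator hs
  have hF : Measurable F := by fun_prop
  have hleft : (Measure.pi fun _ : Fin (n + 1) => gaussianReal 0 1).map
      (fun x => ∑ i, x i ^ 2) s = ∫⁻ x : EuclideanSpace ℝ (Fin (n + 1)), F ‖x‖ := by
    have hm : Measurable fun x : Fin (n + 1) → ℝ => ∑ i, x i ^ 2 := by fun_prop
    rw [← (PiLp.volume_preserving_toLp (Fin (n + 1))).lintegral_comp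
        (f := fun x => F ‖x‖) (hF.comp measurable_norm),
      Measure.map_apply hm hs, ← gaussianRowMeasure_one_eq_pi, gaussianRowMeasure,
      withDensity_apply _ (hm hs), ← lintegral_indicator (hm hs)]
    refine lintegral_congr fun x => ?_
    by_cases h : ∑ i, x i ^ 2 ∈ s <;> simp [F, EuclideanSpace.real_norm_sq_eq, h, hc]
  have hright : chiSquaredMeasure (n + 1) s =
      ∫⁻ r in Set.Ioi (0 : ℝ), ENNReal.ofReal (2 / d) * (ENNReal.ofReal (r ^ n) *
        (s.indicator 1 (r ^ 2) * ENNReal.ofReal (Real.exp (-r ^ 2 / 2)))) := by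
    have himg : (fun r : ℝ => r ^ 2) '' Set.Ioi 0 = Set.Ioi 0 := by
      ext t
      constructor
      · rintro ⟨r, hr, rfl⟩
        exact pow_pos (Set.mem_Ioi.1 hr) 2
      · intro ht
        exact ⟨√t, Real.sqrt_pos.2 ht, Real.sq_sqrt (le_of_lt ht)⟩
    have hchange := lintegral_image_eq_lintegral_abs_deriv_mul (s := Set.Ioi 0)
      (f := fun r : ℝ => r ^ 2) (f' := fun r => 2 * r) measurableSet_Ioi
      (fun r _ => by simpa using (hasDerivAt_pow 2 r).hasDerivWithinAt)
      (fun a ha b hb h => (pow_left_inj₀ (le_of_lt ha) (le_of_lt hb) two_ne_zero).1 h)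
      (fun t => s.indicator 1 t * ENNReal.ofReal (t ^ (((n + 1 : ℕ) : ℝ) / 2 - 1) *
        Real.exp (-t / 2) / d))
    rw [himg] at hchange
    rw [chiSquaredMeasure, withDensity_apply _ hs, ← lintegral_indicator hs]
    trans ∫⁻ t in Set.Ioi (0 : ℝ), s.indicator 1 t *
        ENNReal.ofReal (t ^ (((n + 1 : ℕ) : ℝ) / 2 - 1) * Real.exp (-t / 2) / d)
    · rw [← lintegral_indicator measurableSet_Ioi]
      refine lintegral_congr fun t => ?_
      by_cases h : t ∈ s <;> by_cases h0 : 0 < t <;> simp [h, h0, hd]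
    · rw [hchange]
      refine setLIntegral_congr_fun measurableSet_Ioi fun r hr => ?_
      have hr : 0 < r := hr
      by_cases h : r ^ 2 ∈ s
      · simp only [h, Set.indicator_of_mem, Pi.one_apply, one_mul]
        rw [← ENNReal.ofReal_mul (by positivity), ← ENNReal.ofReal_mul (by positivity),
          ← ENNReal.ofReal_mul (by positivity)]
        congr 1
        have hp : (r ^ 2) ^ (((n + 1 : ℕ) : ℝ) / 2 - 1) * r = r ^ n := by
          rw [← Real.rpow_natCast_mul hr.le, ← Real.rpow_add_one hr.ne', ← Real.rpow_natCast]
          congr 1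
          push_cast
          ring
        rw [abs_of_pos (by positivity), ← hp]
        ring
      · simp [h]
  rw [hleft, hright, lintegral_fun_norm_addHaar _ hF, EuclideanSpace.volume_ball,
    lintegral_const_mul _ (by fun_prop)]
  have hsplit : ∀ r : ℝ, ENNReal.ofReal (r ^ n) * F r = ENNReal.ofReal c *
      (ENNReal.ofReal (r ^ n) * (s.indicator 1 (r ^ 2) *
        ENNReal.ofReal (Real.exp (-r ^ 2 / 2)))) := fun r => by
    simp only [F]
    rw [ENNReal.ofReal_mul (by positivity)]
    ring
  simp only [finrank_euclideanSpace, Fintype.card_fin, Nat.add_sub_cancel, hsplit]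
  rw [lintegral_const_mul _ (by fun_prop), ← mul_assoc]
  congr 1
  have hG : 0 < Real.Gamma (((n + 1 : ℕ) : ℝ) / 2 + 1) := Real.Gamma_pos_of_pos (by positivity)
  rw [← hconst, ENNReal.ofReal_mul (by positivity), ENNReal.ofReal_mul (by positivity),
    ENNReal.ofReal_natCast]
  simp

instance isProbabilityMeasure_chiSquaredMeasure (n : ℕ) :
    IsProbabilityMeasure (chiSquaredMeasure (n + 1)) := by
  rw [← map_sum_sq_pi_gaussianReal]
  exact Measure.isProbabilityMeasure_map (Measurable.aemeasurable (by fun_prop))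

/-- Every vector can be moved to a multiple of the first basis vector by a linear isometry. -/
theorem exists_linearIsometryEquiv_apply_eq_norm_smul {n : ℕ}
    (x : EuclideanSpace ℝ (Fin (n + 1))) :
    ∃ f : EuclideanSpace ℝ (Fin (n + 1)) ≃ₗᵢ[ℝ] EuclideanSpace ℝ (Fin (n + 1)),
      f x = EuclideanSpace.single 0 ‖x‖ :=
  ⟨_, Submodule.reflection_sub (by simp)⟩

/-- The squared determinant is the Gram determinant of the rows, hence is invariant under linear
isometries applied to each row. -/
theorem det_sq_linearIsometryEquiv {n : ℕ}
    (f : EuclideanSpace ℝ (Fin n) ≃ₗᵢ[ℝ] EuclideanSpace ℝ (Fin n)) (M : Fin n → Fin n → ℝ) :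
    (Matrix.of fun i => (f (WithLp.toLp 2 (M i))).ofLp).det ^ 2 = (Matrix.of M).det ^ 2 := by
  have gram (A : Matrix (Fin n) (Fin n) ℝ) : A.det ^ 2 =
      (Matrix.of fun i j => inner ℝ (WithLp.toLp 2 (A i)) (WithLp.toLp 2 (A j))).det := by
    rw [sq]
    nth_rewrite 2 [← Matrix.det_transpose]
    rw [← Matrix.det_mul]
    congr 1
    ext i j
    simp [Matrix.mul_apply, PiLp.inner_apply, mul_comm]
  rw [gram, gram]
  congr 1
  ext i j
  exact f.inner_map_map _ _

/-- The determinant of a matrix whose first row is a multiple of the first basis vector. -/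
theorem det_cons_single {n : ℕ} (a : ℝ) (R : Fin n → Fin (n + 1) → ℝ) :
    (Matrix.of (Fin.cons (Pi.single 0 a) R : Fin (n + 1) → Fin (n + 1) → ℝ)).det =
      a * (Matrix.of fun i j => R i j.succ).det := by
  have hsub : (Matrix.of (Fin.cons (Pi.single 0 a) R : Fin (n + 1) → Fin (n + 1) → ℝ)).submatrix
      Fin.succ Fin.succ = Matrix.of fun i j => R i j.succ := rfl
  rw [Matrix.det_succ_row_zero, Fin.sum_univ_succ]
  simp [hsub]

theorem measurable_det_sq (n : ℕ) :
    Measurable fun M : Fin n → Fin n → ℝ => (Matrix.of M).det ^ 2 := by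
  simp only [Matrix.det_apply', Matrix.of_apply]
  fun_prop

/-- Linear isometries preserve the standard Gaussian measure in coordinates. -/
theorem measurePreserving_linearIsometryEquiv_pi_gaussianReal {n : ℕ}
    (f : EuclideanSpace ℝ (Fin n) ≃ₗᵢ[ℝ] EuclideanSpace ℝ (Fin n)) :
    MeasurePreserving (fun x : Fin n → ℝ => (f (WithLp.toLp 2 x)).ofLp)
      (Measure.pi fun _ => gaussianReal 0 1) (Measure.pi fun _ => gaussianReal 0 1) := by
  have hto : MeasurePreserving (WithLp.toLp 2 : (Fin n → ℝ) → EuclideanSpace ℝ (Fin n))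
      (Measure.pi fun _ => gaussianReal 0 1) (stdGaussian _) :=
    ⟨by fun_prop, map_pi_eq_stdGaussian⟩
  have hf : MeasurePreserving f (stdGaussian (EuclideanSpace ℝ (Fin n))) (stdGaussian _) :=
    ⟨by fun_prop, stdGaussian_map f⟩
  exact (hto.symm (MeasurableEquiv.toLp 2 (Fin n → ℝ))).comp (hf.comp hto)

theorem measurePreserving_tail_pi_gaussianReal (n : ℕ) :
    MeasurePreserving (fun (x : Fin (n + 1) → ℝ) (j : Fin n) => x j.succ)
      (Measure.pi fun _ => gaussianReal 0 1) (Measure.pi fun _ => gaussianReal 0 1) :=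
  measurePreserving_snd.comp
    (measurePreserving_piFinSuccAbove (fun _ : Fin (n + 1) => gaussianReal 0 1) 0)

/-- Conditionally on its first row `x`, the squared determinant of a standard Gaussian matrix is
distributed as `|x|²` times the squared determinant of a standard Gaussian matrix of size one
less. -/
theorem map_det_cons_sq {n : ℕ} (x : Fin (n + 1) → ℝ) :
    (Measure.pi fun _ : Fin n => Measure.pi fun _ : Fin (n + 1) => gaussianReal 0 1).map
        (fun R => (Matrix.of (Fin.cons x R : Fin (n + 1) → Fin (n + 1) → ℝ)).det ^ 2) =
      (Measure.pi fun _ : Fin n => Measure.pi fun _ : Fin n => gaussianReal 0 1).map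
        (fun R => (∑ i, x i ^ 2) * (Matrix.of R).det ^ 2) := by
  obtain ⟨f, hf⟩ := exists_linearIsometryEquiv_apply_eq_norm_smul (WithLp.toLp 2 x)
  have hmp := measurePreserving_pi (fun _ : Fin n => Measure.pi fun _ => gaussianReal 0 1)
    (fun _ : Fin n => Measure.pi fun _ => gaussianReal 0 1) fun _ =>
      (measurePreserving_tail_pi_gaussianReal n).comp
        (measurePreserving_linearIsometryEquiv_pi_gaussianReal f)
  rw [← hmp.map_eq, Measure.map_map ((measurable_det_sq n).const_mul _) hmp.measurable]
  congr 1
  ext R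
  have hrows : (fun i => (f (WithLp.toLp 2
        ((Fin.cons x R : Fin (n + 1) → Fin (n + 1) → ℝ) i))).ofLp) =
      Fin.cons (Pi.single 0 ‖WithLp.toLp 2 x‖) fun i => (f (WithLp.toLp 2 (R i))).ofLp := by
    funext i
    refine Fin.cases ?_ (fun j => ?_) i
    · simp [hf]
    · simp
  rw [← det_sq_linearIsometryEquiv f, hrows, det_cons_single, mul_pow,
    EuclideanSpace.real_norm_sq_eq]
  rfl

/-- The squared determinant of a standard Gaussian matrix is distributed as a product of
independent chi-squared variables. -/
theorem map_det_sq_pi_gaussianReal (n : ℕ) :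
    (Measure.pi fun _ : Fin n => Measure.pi fun _ : Fin n => gaussianReal 0 1).map
        (fun M => (Matrix.of M).det ^ 2) =
      (Measure.pi fun l : Fin n => chiSquaredMeasure ((l : ℕ) + 1)).map
        (fun z => ∏ l, z l) := by
  induction n with
  | zero =>
    simp only [Matrix.det_isEmpty, Finset.univ_eq_empty, Finset.prod_empty, one_pow,
      Measure.map_const, measure_univ]
  | succ n ih =>
    set γ := Measure.pi fun _ : Fin (n + 1) => gaussianReal 0 1
    set P := Measure.pi fun _ : Fin n => γ
    set G := Measure.pi fun _ : Fin n => Measure.pi fun _ : Fin n => gaussianReal 0 1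
    have hsq : Measurable fun x : Fin (n + 1) → ℝ => ∑ i, x i ^ 2 := by fun_prop
    have hdet := measurable_det_sq n
    have hcons : Measurable fun p : (Fin (n + 1) → ℝ) × (Fin n → Fin (n + 1) → ℝ) =>
        (Fin.cons p.1 p.2 : Fin (n + 1) → Fin (n + 1) → ℝ) :=
      measurable_pi_iff.2 fun i => by
        refine Fin.cases ?_ (fun j => ?_) i
        · simpa using measurable_fst
        · exact (measurable_pi_apply j).comp measurable_snd
    have hdetcons : Measurable fun p : (Fin (n + 1) → ℝ) × (Fin n → Fin (n + 1) → ℝ) =>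
        (Matrix.of (Fin.cons p.1 p.2 : Fin (n + 1) → Fin (n + 1) → ℝ)).det ^ 2 :=
      (measurable_det_sq (n + 1)).comp hcons
    have hmul : Measurable fun p : (Fin (n + 1) → ℝ) × (Fin n → Fin n → ℝ) =>
        (∑ i, p.1 i ^ 2) * (Matrix.of p.2).det ^ 2 :=
      (hsq.comp measurable_fst).mul (hdet.comp measurable_snd)
    calc
      _ = (γ.prod P).map fun p =>
          (Matrix.of (Fin.cons p.1 p.2 : Fin (n + 1) → Fin (n + 1) → ℝ)).det ^ 2 := by
        have e := (measurePreserving_piFinSuccAbove (fun _ : Fin (n + 1) => γ) 0).symm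
        rw [← e.map_eq, Measure.map_map (measurable_det_sq _) e.measurable]
        congr 1
        ext p
        simp [MeasurableEquiv.piFinSuccAbove_symm_apply, Fin.insertNthEquiv]
      _ = (γ.prod G).map fun p => (∑ i, p.1 i ^ 2) * (Matrix.of p.2).det ^ 2 := by
        ext s hs
        rw [Measure.map_apply hdetcons hs, Measure.map_apply hmul hs,
          Measure.prod_apply (hdetcons hs), Measure.prod_apply (hmul hs)]
        refine lintegral_congr fun x => ?_
        have h := DFunLike.congr_fun (map_det_cons_sq x) s
        have hx : Measurable fun R : Fin n → Fin (n + 1) → ℝ =>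
            (Matrix.of (Fin.cons x R : Fin (n + 1) → Fin (n + 1) → ℝ)).det ^ 2 :=
          hdetcons.comp measurable_prodMk_left
        rwa [Measure.map_apply hx hs,
          Measure.map_apply (hdet.const_mul _) hs] at h
      _ = ((γ.map fun x => ∑ i, x i ^ 2).prod (G.map fun M => (Matrix.of M).det ^ 2)).map
          fun p => p.1 * p.2 := by
        rw [Measure.map_prod_map _ _ hsq hdet,
          Measure.map_map (by fun_prop) (hsq.prodMap hdet)]
        rfl
      _ = ((chiSquaredMeasure (n + 1)).prod
            (Measure.pi fun l : Fin n => chiSquaredMeasure ((l : ℕ) + 1))).map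
          fun p => p.1 * ∏ l, p.2 l := by
        have hprod : Measurable fun z : Fin n → ℝ => ∏ l, z l := by fun_prop
        rw [ih, map_sum_sq_pi_gaussianReal]
        nth_rewrite 1 [← Measure.map_id (μ := chiSquaredMeasure (n + 1))]
        rw [Measure.map_prod_map _ _ measurable_id hprod,
          Measure.map_map (by fun_prop) (measurable_id.prodMap hprod)]
        rfl
      _ = _ := by
        have e := measurePreserving_piFinSuccAbove
          (fun l : Fin (n + 1) => chiSquaredMeasure ((l : ℕ) + 1)) (Fin.last n)
        simp only [Fin.succAbove_last, Fin.val_last, Fin.val_castSucc] at e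
        rw [← e.map_eq, Measure.map_map (by fun_prop) e.measurable]
        congr 1
        ext z
        simp [Fin.prod_univ_castSucc, mul_comm, MeasurableEquiv.piFinSuccAbove_apply,
          Fin.insertNthEquiv, Fin.init]

theorem statement1 (N : ℕ) (hN : 0 < N) (σ : Fin N → ℝ) (hσ : ∀ l, 0 < σ l) :
    Measure.map (fun M : Fin N → Fin N → ℝ => Matrix.det (Matrix.of M) ^ 2)
        (Measure.pi fun l => gaussianRowMeasure N (σ l)) =
      Measure.map (fun z : Fin N → ℝ => ∏ l, σ l ^ 2 * z l)
        (Measure.pi fun l : Fin N => chiSquaredMeasure ((l : ℕ) + 1)) := by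
  have hscale : MeasurePreserving
      (fun (M : Fin N → Fin N → ℝ) (l : Fin N) (i : Fin N) => σ l * M l i)
      (Measure.pi fun _ => Measure.pi fun _ => gaussianReal 0 1)
      (Measure.pi fun l => gaussianRowMeasure N (σ l)) := by
    have (l : Fin N) : SigmaFinite (gaussianRowMeasure N (σ l)) := by
      rw [gaussianRowMeasure_eq_pi N (hσ l)]
      infer_instance
    exact measurePreserving_pi (f := fun l (x : Fin N → ℝ) i => σ l * x i) _ _ fun l =>
      ⟨by fun_prop, (gaussianRowMeasure_eq_map N (hσ l)).symm⟩
  have hdet (M : Fin N → Fin N → ℝ) : (Matrix.of fun l i => σ l * M l i).det ^ 2 =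
      (∏ l, σ l ^ 2) * (Matrix.of M).det ^ 2 := by
    have h := Matrix.det_mul_column σ (Matrix.of M)
    simp only [Matrix.of_apply] at h
    rw [h, mul_pow, Finset.prod_pow]
  have hprod : Measurable fun z : Fin N → ℝ => ∏ l, z l := by fun_prop
  rw [← hscale.map_eq, Measure.map_map (measurable_det_sq N) hscale.measurable]
  simp only [Function.comp_def, hdet, Finset.prod_mul_distrib]
  have h := congrArg (Measure.map ((∏ l, σ l ^ 2) * ·)) (map_det_sq_pi_gaussianReal N)
  rwa [Measure.map_map (by fun_prop) (measurable_det_sq N),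
    Measure.map_map (by fun_prop) hprod] at h
end
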